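/- arXiv:2109.14043 — 2 statements merged into one kernel-verified Lean document; each statement's English description precedes it below -/
import Mathlib

section
/- Suppose M is M^(Λ)-projective for every index set Λ and M = ⊕_{i∈I} M_i. Then 𝔏(M) = ⊕_{i∈I} 𝔏(M_i). -/
open Function

universe u v

variable (R : Type u) [Ring R]

/-- The product `A ·_M B = Σ { f(A) ∣ f ∈ Hom_R(M, B) }` of two submodules of `M`. -/
def smulMod {M : Type v} [AddCommGroup M] [Module R M] (A B : Submodule R M) :
    Submodule R M :=
  ⨆ f : M →ₗ[R] ↥B, A.map (B.subtype ∘ₗ f)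

/-- Powers: `spowMod N k = N^(k+1)`, i.e. `N^1 = N`, `N^(ℓ+1) = N^ℓ ·_M N`. -/
def spowMod {M : Type v} [AddCommGroup M] [Module R M] (N : Submodule R M) :
    ℕ → Submodule R M
  | 0 => N
  | k + 1 => smulMod R (spowMod N k) N

/-- A submodule is nilpotent if some power of it (w.r.t. the product `·_M`) is zero. -/
def IsNilpotentSubmodule {M : Type v} [AddCommGroup M] [Module R M]
    (N : Submodule R M) : Prop :=
  ∃ k : ℕ, spowMod R N k = ⊥

/-- Left-associated product of a nonempty finite family of submodules. -/
def chainProd {M : Type v} [AddCommGroup M] [Module R M] :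
    {ℓ : ℕ} → (Fin (ℓ + 1) → Submodule R M) → Submodule R M
  | 0, A => A 0
  | ℓ + 1, A => smulMod R (chainProd fun i => A i.castSucc) (A (Fin.last (ℓ + 1)))

/-- `N` is a locally nilpotent submodule of `M`. -/
def IsLocallyNilpotentSubmodule {M : Type v} [AddCommGroup M] [Module R M]
    (N : Submodule R M) : Prop :=
  ∀ (k : ℕ) (n : Fin k → M), (∀ i, n i ∈ N) →
    ∃ ℓ : ℕ, ∀ idx : Fin (ℓ + 1) → Fin k,
      chainProd R (fun j => (R ∙ n (idx j) : Submodule R M)) = ⊥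

/-- `N` is a nil-submodule of `M`: every `f : M → Rn` with `n ∈ N` is nilpotent. -/
def IsNilSubmodule {M : Type v} [AddCommGroup M] [Module R M]
    (N : Submodule R M) : Prop :=
  ∀ n ∈ N, ∀ f : Module.End R M, LinearMap.range f ≤ (R ∙ n) → IsNilpotent f

def IsFullyInvariant {M : Type v} [AddCommGroup M] [Module R M]
    (N : Submodule R M) : Prop :=
  ∀ f : Module.End R M, N.map f ≤ N

def IsPrimeSubmodule {M : Type v} [AddCommGroup M] [Module R M]
    (P : Submodule R M) : Prop :=
  IsFullyInvariant R P ∧ P ≠ ⊤ ∧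
    ∀ A B : Submodule R M, IsFullyInvariant R A → IsFullyInvariant R B →
      smulMod R A B ≤ P → A ≤ P ∨ B ≤ P

def IsSemiprimeSubmodule {M : Type v} [AddCommGroup M] [Module R M]
    (P : Submodule R M) : Prop :=
  IsFullyInvariant R P ∧
    ∀ A : Submodule R M, IsFullyInvariant R A → smulMod R A A ≤ P → A ≤ P

/-- The prime radical of `M`: the intersection of all prime submodules. -/
def primeRadical (M : Type v) [AddCommGroup M] [Module R M] : Submodule R M :=
  sInf {P : Submodule R M | IsPrimeSubmodule R P}

/-- `𝔏(M)`: the sum of all locally nilpotent submodules of `M`. -/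
def locNilRad (M : Type v) [AddCommGroup M] [Module R M] : Submodule R M :=
  sSup {N : Submodule R M | IsLocallyNilpotentSubmodule R N}

/-- `M` is quasi-projective (`M`-projective). -/
def IsQuasiProjective (M : Type v) [AddCommGroup M] [Module R M] : Prop :=
  ∀ (K : Submodule R M) (g : M →ₗ[R] M ⧸ K), ∃ h : M →ₗ[R] M, K.mkQ ∘ₗ h = g

/-- `M` is `M^(Λ)`-projective for every index set `Λ`. -/
def IsDirSumSelfProjective (M : Type v) [AddCommGroup M] [Module R M] : Prop :=
  ∀ (ι : Type v) (K : Submodule R (ι →₀ M)) (g : M →ₗ[R] (ι →₀ M) ⧸ K),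
    ∃ h : M →ₗ[R] (ι →₀ M), K.mkQ ∘ₗ h = g

/-- `ann_M(N) = ⋂ { Ker f ∣ f ∈ Hom_R(M, N) }`. -/
def annIn {M : Type v} [AddCommGroup M] [Module R M] (N : Submodule R M) :
    Submodule R M :=
  ⨅ f : M →ₗ[R] ↥N, LinearMap.ker f

/-- `ann_M^r(N) = Σ { K ≤ M ∣ N ·_M K = 0 }`. -/
def rannIn {M : Type v} [AddCommGroup M] [Module R M] (N : Submodule R M) :
    Submodule R M :=
  sSup {K : Submodule R M | smulMod R N K = ⊥}

/-- `M` is retractable: `Hom_R(M, K) ≠ 0` for every nonzero `K ≤ M`. -/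
def IsRetractable (M : Type v) [AddCommGroup M] [Module R M] : Prop :=
  ∀ K : Submodule R M, K ≠ ⊥ → ∃ f : M →ₗ[R] ↥K, f ≠ 0

/-- `⋂_{f ∈ Y} Ker f` for a set `Y` of endomorphisms. -/
def kerInt {M : Type v} [AddCommGroup M] [Module R M]
    (Y : Set (Module.End R M)) : Submodule R M :=
  ⨅ f ∈ Y, LinearMap.ker f

/-- `M` satisfies the acc on annihilators. -/
def AccOnAnnihilators (M : Type v) [AddCommGroup M] [Module R M] : Prop :=
  ∀ c : ℕ → Set (Module.End R M),
    (∀ i, kerInt R (c i) ≤ kerInt R (c (i + 1))) →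
      ∃ n : ℕ, ∀ m : ℕ, n ≤ m → kerInt R (c m) = kerInt R (c n)

/-- `M` has finite uniform dimension: there is no infinite independent family of
nonzero submodules. -/
def FiniteUniformDimension (M : Type v) [AddCommGroup M] [Module R M] : Prop :=
  ¬ ∃ f : ℕ → Submodule R M, iSupIndep f ∧ ∀ i, f i ≠ ⊥

/-- `M` is a Goldie module. -/
def IsGoldieModule (M : Type v) [AddCommGroup M] [Module R M] : Prop :=
  AccOnAnnihilators R M ∧ FiniteUniformDimension R M

theorem smulMod_le_iff' {M : Type v} [AddCommGroup M] [Module R M] (A B C : Submodule R M) :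
    smulMod R A B ≤ C ↔ ∀ f : M →ₗ[R] M, (∀ m, f m ∈ B) → ∀ a ∈ A, f a ∈ C := by
  unfold smulMod
  rw [iSup_le_iff]
  constructor
  · intro h f hf a ha
    exact h (f.codRestrict B hf) (Submodule.mem_map.2 ⟨a, ha, rfl⟩)
  · rintro h f _ ⟨a, ha, rfl⟩
    exact h (B.subtype ∘ₗ f) (fun m => (f m).2) a ha

theorem mem_smulMod' {M : Type v} [AddCommGroup M] [Module R M] (A B : Submodule R M)
    (f : M →ₗ[R] M) (hf : ∀ m, f m ∈ B) (a : M) (ha : a ∈ A) : f a ∈ smulMod R A B :=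
  (smulMod_le_iff' R A B _).1 le_rfl f hf a ha

theorem quasi_of_dirSum {M : Type v} [AddCommGroup M] [Module R M]
    (hproj : IsDirSumSelfProjective R M) : IsQuasiProjective R M := by
  intro K g
  let e : (PUnit.{v+1} →₀ M) ≃ₗ[R] M := Finsupp.uniqueLinearEquiv R M PUnit.unit
  let K' := K.comap e.toLinearMap
  let q : (M ⧸ K) →ₗ[R] (PUnit.{v+1} →₀ M) ⧸ K' :=
    K.mapQ K' e.symm.toLinearMap (by intro x hx; simpa [K'] using hx)
  obtain ⟨h, hh⟩ := hproj PUnit K' (q ∘ₗ g)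
  refine ⟨e.toLinearMap ∘ₗ h, ?_⟩
  ext m
  have h1 := LinearMap.congr_fun hh m
  obtain ⟨y, hy⟩ := K.mkQ_surjective (g m)
  simp only [LinearMap.comp_apply, ← hy] at h1 ⊢
  have h2 : K'.mkQ (h m) = K'.mkQ (e.symm y) := h1
  rw [Submodule.mkQ_apply, Submodule.mkQ_apply, Submodule.Quotient.eq] at h2 ⊢
  simpa [K'] using h2

theorem lift_span {M : Type v} [AddCommGroup M] [Module R M]
    (hq : IsQuasiProjective R M) (e f : M →ₗ[R] M) (X : Submodule R M)
    (hf : ∀ m, f m ∈ X.map e) : ∃ g : M →ₗ[R] M, (∀ m, g m ∈ X) ∧ ∀ m, e (g m) = f m := by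
  let p : X →ₗ[R] M := e ∘ₗ X.subtype
  have hr : ∀ m, f m ∈ LinearMap.range p := by
    intro m
    obtain ⟨x, hx, h⟩ := hf m
    exact ⟨⟨x, hx⟩, h⟩
  let K := (LinearMap.ker p).map X.subtype
  let q : (X ⧸ LinearMap.ker p) →ₗ[R] M ⧸ K :=
    (LinearMap.ker p).mapQ K X.subtype (Submodule.le_comap_map _ _)
  obtain ⟨h, hh⟩ := hq K (q ∘ₗ p.quotKerEquivRange.symm.toLinearMap ∘ₗ f.codRestrict _ hr)
  have key : ∀ m, h m ∈ X ∧ e (h m) = f m := by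
    intro m
    obtain ⟨x, hx⟩ := hr m
    have h1 := LinearMap.congr_fun hh m
    have h3 : p.quotKerEquivRange.symm (f.codRestrict _ hr m) = (LinearMap.ker p).mkQ x := by
      rw [LinearEquiv.symm_apply_eq]
      ext
      simp [hx]
    have h2 : K.mkQ (h m) = K.mkQ (x : M) := by
      refine h1.trans ?_
      simp only [LinearMap.comp_apply, LinearEquiv.coe_coe]
      rw [h3]
      rfl
    rw [Submodule.mkQ_apply, Submodule.mkQ_apply, Submodule.Quotient.eq] at h2
    obtain ⟨y, hy, hy2⟩ := h2
    have h4 : h m = ((y + x : X) : M) := by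
      rw [Submodule.coe_add]
      exact eq_add_of_sub_eq hy2.symm
    refine ⟨h4 ▸ (y + x).2, ?_⟩
    have : e (h m) = p (y + x) := by rw [h4]; rfl
    rw [this, map_add, hx, LinearMap.mem_ker.1 hy, zero_add]
  exact ⟨h, fun m => (key m).1, fun m => (key m).2⟩

theorem chain_map_le {M : Type v} [AddCommGroup M] [Module R M]
    (hq : IsQuasiProjective R M) (e : M →ₗ[R] M) : ∀ (ℓ : ℕ) (A : Fin (ℓ + 1) → Submodule R M),
    chainProd R (fun j => (A j).map e) ≤ (chainProd R A).map e
  | 0, A => le_rfl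
  | ℓ + 1, A => by
    simp only [chainProd]
    rw [smulMod_le_iff']
    intro f hf a ha
    obtain ⟨c, hc, rfl⟩ := chain_map_le hq e ℓ _ ha
    obtain ⟨g, hg, hgf⟩ := lift_span R hq e f _ hf
    rw [← hgf]
    exact ⟨_, mem_smulMod' R _ _ (g ∘ₗ e) (fun m => hg _) c hc, rfl⟩

theorem chain_summand {M : Type v} [AddCommGroup M] [Module R M] (N : Submodule R M)
    (p : M →ₗ[R] N) (hp : ∀ x : N, p x = x) : ∀ (ℓ : ℕ) (A : Fin (ℓ + 1) → Submodule R N),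
    chainProd R (fun j => (A j).map N.subtype) = (chainProd R A).map N.subtype
  | 0, A => rfl
  | ℓ + 1, A => by
    simp only [chainProd]
    rw [chain_summand N p hp ℓ]
    apply le_antisymm
    · rw [smulMod_le_iff']
      rintro f hf _ ⟨c, hc, rfl⟩
      obtain ⟨y, hy, hy2⟩ := hf (N.subtype c)
      have hfN : ∀ m, f m ∈ N := fun m => by
        obtain ⟨z, hz, h⟩ := hf m
        rw [← h]; exact z.2
      refine ⟨_, mem_smulMod' R _ _ ((f.codRestrict N hfN) ∘ₗ N.subtype) (fun m => ?_) c hc, rfl⟩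
      obtain ⟨z, hz, h⟩ := hf (N.subtype m)
      have : z = ((f.codRestrict N hfN) ∘ₗ N.subtype) m := Subtype.ext h
      rwa [← this]
    · rw [Submodule.map_le_iff_le_comap, smulMod_le_iff']
      intro f hf a ha
      have := mem_smulMod' R (Submodule.map N.subtype (chainProd R fun i => A i.castSucc))
        (Submodule.map N.subtype (A (Fin.last (ℓ + 1)))) (N.subtype ∘ₗ f ∘ₗ p)
        (fun m => ⟨_, hf _, rfl⟩) (N.subtype a) ⟨a, ha, rfl⟩
      simpa [hp] using this

theorem locNil_map {M : Type v} [AddCommGroup M] [Module R M]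
    (hq : IsQuasiProjective R M) (e : M →ₗ[R] M) (L : Submodule R M)
    (hL : IsLocallyNilpotentSubmodule R L) : IsLocallyNilpotentSubmodule R (L.map e) := by
  intro k n hn
  choose x hx hxn using hn
  obtain ⟨ℓ, h⟩ := hL k x hx
  refine ⟨ℓ, fun idx => ?_⟩
  have := chain_map_le R hq e ℓ (fun j => R ∙ x (idx j))
  rw [h idx, Submodule.map_bot, le_bot_iff] at this
  simpa [Submodule.map_span, hxn] using this

theorem locNil_summand {M : Type v} [AddCommGroup M] [Module R M] (N : Submodule R M)
    (p : M →ₗ[R] N) (hp : ∀ x : N, p x = x) (L : Submodule R N) :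
    IsLocallyNilpotentSubmodule R (L.map N.subtype) ↔ IsLocallyNilpotentSubmodule R L := by
  have key : ∀ (ℓ : ℕ) (x : Fin (ℓ + 1) → N),
      chainProd R (fun j => R ∙ (x j : M)) = ⊥ ↔ chainProd R (fun j => R ∙ x j) = ⊥ := by
    intro ℓ x
    have := chain_summand R N p hp ℓ (fun j => R ∙ x j)
    simp only [Submodule.map_span, Set.image_singleton, Submodule.subtype_apply] at this
    rw [this]
    constructor
    · intro h
      exact Submodule.map_injective_of_injective N.injective_subtype (by rw [h, Submodule.map_bot])
    · intro h
      rw [h, Submodule.map_bot]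
  constructor
  · intro h k n hn
    obtain ⟨ℓ, h⟩ := h k (fun i => n i) (fun i => ⟨_, hn i, rfl⟩)
    exact ⟨ℓ, fun idx => (key ℓ (fun j => n (idx j))).1 (h idx)⟩
  · intro h k n hn
    choose x hx hxn using hn
    obtain ⟨ℓ, h⟩ := h k x hx
    refine ⟨ℓ, fun idx => ?_⟩
    have := (key ℓ (fun j => x (idx j))).2 (h idx)
    simpa [← hxn] using this

theorem locNilRad_directSum {M : Type v} [AddCommGroup M] [Module R M]
    (hproj : IsDirSumSelfProjective R M) {ι : Type v} (N : ι → Submodule R M)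
    (hind : iSupIndep N) (hsum : ⨆ i, N i = ⊤) :
    locNilRad R M = ⨆ i, (locNilRad R ↥(N i)).map (N i).subtype := by
  have hq := quasi_of_dirSum R hproj
  have hex : ∀ i, ∃ p : M →ₗ[R] N i, (∀ x : N i, p x = x) ∧ ∀ j, j ≠ i → ∀ x ∈ N j, p x = 0 := by
    intro i
    have hc : IsCompl (N i) (⨆ j, ⨆ (_ : j ≠ i), N j) := by
      refine ⟨hind i, codisjoint_iff_le_sup.2 ?_⟩
      rw [← hsum]
      refine iSup_le fun j => ?_
      by_cases hj : j = i
      · subst hj; exact le_sup_left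
      · exact le_sup_of_le_right (le_iSup₂_of_le j hj le_rfl)
    refine ⟨Submodule.projectionOnto _ _ hc, fun x => ?_, fun j hj x hx => ?_⟩
    · exact Submodule.projectionOnto_apply_left hc x
    · exact (Submodule.projectionOnto_apply_eq_zero_iff hc).2
        (Submodule.mem_iSup_of_mem j (Submodule.mem_iSup_of_mem hj hx))
  choose p hp hp0 using hex
  apply le_antisymm
  · refine sSup_le fun L hL x hx => ?_
    have hmem : ∀ i, ((p i x : N i) : M) ∈ (locNilRad R ↥(N i)).map (N i).subtype := by
      intro i
      refine ⟨p i x, ?_, rfl⟩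
      have h1 := locNil_map R hq ((N i).subtype ∘ₗ p i) L hL
      rw [Submodule.map_comp, locNil_summand R (N i) (p i) (hp i)] at h1
      exact le_sSup (a := L.map (p i)) h1 ⟨x, hx, rfl⟩
    have hxt : x ∈ ⨆ i, N i := hsum ▸ Submodule.mem_top
    obtain ⟨y, hy, hyx⟩ := (Submodule.mem_iSup_iff_exists_finsupp _ _).1 hxt
    have hpy : ∀ i, ((p i x : N i) : M) = y i := by
      intro i
      rw [← hyx, Finsupp.sum, map_sum, Finset.sum_eq_single i]
      · exact congrArg _ (hp i ⟨y i, hy i⟩)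
      · intro j _ hj
        exact hp0 i j hj _ (hy j)
      · intro hi
        rw [Finsupp.notMem_support_iff.1 hi, map_zero]
    rw [← hyx]
    refine Submodule.sum_mem _ fun i _ => Submodule.mem_iSup_of_mem i ?_
    have := hmem i
    rwa [hpy] at this
  · refine iSup_le fun i => ?_
    rw [Submodule.map_le_iff_le_comap]
    refine sSup_le fun L hL => ?_
    rw [← Submodule.map_le_iff_le_comap]
    exact le_sSup ((locNil_summand R (N i) (p i) (hp i) L).2 hL)
end

section
/- Suppose M is M^(Λ)-projective for every index set Λ and retractable. If M is a Goldie module and N < M is a fully invariant nil-submodule, then N is nilpotent. In particular, the prime radical of M is nilpotent. -/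
open Function

universe u v

variable (R : Type u) [Ring R]

section NilHelpers

open scoped Pointwise

variable {M : Type v} [AddCommGroup M] [Module R M]

/-- Decomposition of endomorphisms with image in a sum of submodules. -/
theorem aux_proj_decomp (hproj : IsDirSumSelfProjective R M) {ι : Type v}
    (B : ι → Submodule R M) (f : Module.End R M) (hf : LinearMap.range f ≤ ⨆ i, B i) :
    ∃ h : ι → Module.End R M, (∀ i, LinearMap.range (h i) ≤ B i) ∧
      ∀ x, f x ∈ Submodule.span R (Set.range fun i => h i x) := by
  classical
  let σ : (ι →₀ M) →ₗ[R] M := Finsupp.lsum ℕ (fun _ => LinearMap.id)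
  let D : Submodule R (ι →₀ M) :=
    { carrier := {v | ∀ i, v i ∈ B i}
      add_mem' := fun {a b} ha hb i => by
        simpa using (B i).add_mem (ha i) (hb i)
      zero_mem' := fun i => by simp
      smul_mem' := fun c a ha i => by
        simpa using (B i).smul_mem c (ha i) }
  have hD : ∀ v : ι →₀ M, v ∈ D ↔ ∀ i, v i ∈ B i := fun v => Iff.rfl
  have hle : (⨆ i, B i) ≤ D.map σ := by
    refine iSup_le fun i x hx => ?_
    refine ⟨Finsupp.single i x, ?_, by simp [σ]⟩
    intro j
    by_cases hij : i = j
    · subst hij; simpa using hx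
    · rw [Finsupp.single_eq_of_ne (Ne.symm hij)]; exact zero_mem _
  have hv : ∀ x, ∃ v ∈ D, σ v = f x := fun x => hle (hf ⟨x, rfl⟩)
  choose v hvD hvσ using hv
  let K : Submodule R (ι →₀ M) := D ⊓ LinearMap.ker σ
  let g : M →ₗ[R] (ι →₀ M) ⧸ K :=
    { toFun := fun x => K.mkQ (v x)
      map_add' := fun x y => by
        rw [← map_add, ← sub_eq_zero, ← map_sub]
        simp only [Submodule.mkQ_apply, Submodule.Quotient.mk_eq_zero]
        refine ⟨D.sub_mem (hvD _) (D.add_mem (hvD _) (hvD _)), ?_⟩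
        simp [hvσ]
      map_smul' := fun c x => by
        rw [RingHom.id_apply, ← map_smul, ← sub_eq_zero, ← map_sub]
        simp only [Submodule.mkQ_apply, Submodule.Quotient.mk_eq_zero]
        refine ⟨D.sub_mem (hvD _) (D.smul_mem _ (hvD _)), ?_⟩
        simp [hvσ] }
  obtain ⟨h, hh⟩ := hproj ι K g
  have hK : ∀ x, h x - v x ∈ K := fun x => by
    have := LinearMap.congr_fun hh x
    have h2 : K.mkQ (h x) = K.mkQ (v x) := this
    rw [Submodule.mkQ_apply, Submodule.mkQ_apply, Submodule.Quotient.eq] at h2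
    exact h2
  have hhD : ∀ x, h x ∈ D := fun x => by
    have := D.add_mem (hK x).1 (hvD x)
    simpa using this
  have hhσ : ∀ x, σ (h x) = f x := fun x => by
    have h1 : σ (h x - v x) = 0 := (hK x).2
    rw [map_sub, sub_eq_zero] at h1
    rw [h1, hvσ]
  refine ⟨fun i => Finsupp.lapply i ∘ₗ h, ?_, ?_⟩
  · rintro i _ ⟨x, rfl⟩
    exact hhD x i
  · intro x
    rw [← hhσ x]
    have : σ (h x) = (h x).sum fun _ y => y := by
      simp only [σ, Finsupp.lsum_apply]; rfl
    rw [this]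
    exact Submodule.sum_mem _ fun i _ => Submodule.subset_span ⟨i, rfl⟩

theorem aux_smulMod_mem {A B : Submodule R M} (f : Module.End R M)
    (hf : LinearMap.range f ≤ B) {a : M} (ha : a ∈ A) : f a ∈ smulMod R A B := by
  let f' : M →ₗ[R] B := f.codRestrict B fun x => hf ⟨x, rfl⟩
  have : A.map (B.subtype ∘ₗ f') ≤ smulMod R A B :=
    le_iSup (fun f : M →ₗ[R] B => A.map (B.subtype ∘ₗ f)) f'
  exact this ⟨a, ha, rfl⟩

/-- Endomorphisms with image in a cyclic submodule of `N`. -/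
def auxCyc (N : Submodule R M) : Set (Module.End R M) :=
  {f | ∃ n ∈ N, LinearMap.range f ≤ (R ∙ n)}

theorem auxCyc_mul_right {N : Submodule R M} {f : Module.End R M} (hf : f ∈ auxCyc R N)
    (g : Module.End R M) : f * g ∈ auxCyc R N := by
  obtain ⟨n, hn, h⟩ := hf
  refine ⟨n, hn, ?_⟩
  rintro _ ⟨x, rfl⟩
  exact h ⟨g x, rfl⟩

theorem auxCyc_mul_left {N : Submodule R M} (hfi : IsFullyInvariant R N)
    {f : Module.End R M} (hf : f ∈ auxCyc R N)
    (g : Module.End R M) : g * f ∈ auxCyc R N := by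
  obtain ⟨n, hn, h⟩ := hf
  refine ⟨g n, hfi g ⟨n, hn, rfl⟩, ?_⟩
  rintro _ ⟨x, rfl⟩
  obtain ⟨c, hc⟩ := Submodule.mem_span_singleton.1 (h ⟨x, rfl⟩)
  refine Submodule.mem_span_singleton.2 ⟨c, ?_⟩
  rw [← map_smul, hc]; rfl

theorem aux_mem_kerInt {Y : Set (Module.End R M)} {x : M} :
    x ∈ kerInt R Y ↔ ∀ f ∈ Y, f x = 0 := by
  simp [kerInt]

theorem aux_exists_max (hacc : AccOnAnnihilators R M) (Y : Set (Module.End R M))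
    (hY : Y.Nonempty) : ∃ f ∈ Y, ∀ g ∈ Y, LinearMap.ker f ≤ LinearMap.ker g →
      LinearMap.ker g ≤ LinearMap.ker f := by
  by_contra hcon
  push Not at hcon
  choose! F hFY hF1 hF2 using hcon
  obtain ⟨f0, hf0⟩ := hY
  let s : ℕ → Module.End R M := fun n => F^[n] f0
  have hsY : ∀ n, s n ∈ Y := by
    intro n
    induction n with
    | zero => exact hf0
    | succ n ih =>
      simp only [s, Function.iterate_succ_apply']
      exact hFY _ ih
  have hss : ∀ n, s (n + 1) = F (s n) := fun n => Function.iterate_succ_apply' F n f0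
  have hk : ∀ f : Module.End R M, kerInt R {f} = LinearMap.ker f := fun f => by simp [kerInt]
  obtain ⟨n, hn⟩ := hacc (fun n => {s n}) (fun i => by
    rw [hk, hk, hss]; exact hF1 _ (hsY i))
  have := hn (n + 1) (Nat.le_succ n)
  rw [hk, hk, hss] at this
  exact hF2 _ (hsY n) this.le

theorem aux_indep (K : ℕ → Submodule R M) (d : ℕ → Module.End R M)
    (h1 : ∀ i k, i < k → ∀ x ∈ K k, d i x = 0)
    (h2 : ∀ i, ∀ x ∈ K i, d i x = 0 → x = 0) : iSupIndep K := by
  classical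
  apply iSupIndep_of_dfinsupp_lsum_injective
  rw [injective_iff_map_eq_zero]
  intro m hm
  have hm' : ∑ i ∈ m.support, (m i : M) = 0 := by
    rw [DFinsupp.lsum_apply_apply, DFinsupp.sumAddHom_apply] at hm
    exact hm
  ext i
  induction i using Nat.strong_induction_on with
  | _ i ih =>
    apply h2 i _ (m i).2
    have h3 : ∑ k ∈ m.support, d i (m k : M) = 0 := by rw [← map_sum, hm', map_zero]
    by_cases hi : i ∈ m.support
    · rwa [Finset.sum_eq_single i] at h3
      · intro k _ hki
        rcases lt_or_gt_of_ne hki with h | h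
        · have := ih k h
          rw [this]; simp
        · exact h1 i k h _ (m k).2
      · intro h; exact absurd hi h
    · have : m i = 0 := by simpa using hi
      rw [this]; simp

theorem aux_cyc_nilpotent (hG : IsGoldieModule R M) (N : Submodule R M)
    (hfi : IsFullyInvariant R N) (hnil : IsNilSubmodule R N) :
    ∃ n : ℕ, ∀ p ∈ (auxCyc R N) ^ n, p = 0 := by
  obtain ⟨hacc, hud⟩ := hG
  set J := auxCyc R N with hJ
  obtain ⟨n, hn⟩ := hacc (fun k => J ^ k) (by
    intro i x hx
    rw [aux_mem_kerInt] at hx ⊢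
    intro f hf
    rw [pow_succ'] at hf
    obtain ⟨a, _, b, hb, rfl⟩ := hf
    have := hx b hb
    simp [this])
  set A := kerInt R (J ^ n) with hA
  have hA' : ∀ x, x ∈ A ↔ ∀ f ∈ J ^ n, f x = 0 := fun x => aux_mem_kerInt R
  refine ⟨n, ?_⟩
  by_contra hcon
  push Not at hcon
  obtain ⟨p0, hp0, hp0ne⟩ := hcon
  let Good : Module.End R M → Prop := fun g => ∃ x, g x ∉ A
  have hgood1 : Good 1 := by
    by_contra hc
    simp only [Good, not_exists, not_not] at hc
    exact hp0ne (LinearMap.ext fun x => (hA' x).1 (hc x) p0 hp0)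
  have hstep : ∀ g, Good g → ∃ f ∈ J, Good (f * g) := by
    rintro g ⟨x, hx⟩
    by_contra hc
    simp only [Good, not_exists, not_and, not_not] at hc
    apply hx
    have h1 : g x ∈ kerInt R (J ^ (n + 1)) := by
      rw [aux_mem_kerInt]
      intro f hf
      rw [pow_succ] at hf
      obtain ⟨a, ha, b, hb, rfl⟩ := hf
      exact (hA' _).1 (hc b hb x) a ha
    exact (hn (n + 1) (Nat.le_succ n)).le h1
  have hmax : ∀ g, Good g → ∃ f ∈ J, Good (f * g) ∧ ∀ f' ∈ J, Good (f' * g) →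
      LinearMap.ker f ≤ LinearMap.ker f' → LinearMap.ker f' ≤ LinearMap.ker f := by
    intro g hg
    obtain ⟨f, hf, hm⟩ := aux_exists_max R hacc {f | f ∈ J ∧ Good (f * g)}
      (by obtain ⟨f, h1, h2⟩ := hstep g hg; exact ⟨f, h1, h2⟩)
    exact ⟨f, hf.1, hf.2, fun f' h1 h2 => hm f' ⟨h1, h2⟩⟩
  choose! α hαJ hαG hαM using hmax
  let b : ℕ → Module.End R M := fun k => (fun g => α g * g)^[k] 1
  have hb0 : b 0 = 1 := rfl
  have hbs : ∀ k, b (k + 1) = α (b k) * b k := fun k =>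
    Function.iterate_succ_apply' (fun g => α g * g) k 1
  have hbG : ∀ k, Good (b k) := by
    intro k
    induction k with
    | zero => exact hgood1
    | succ k ih => rw [hbs]; exact hαG _ ih
  let a : ℕ → Module.End R M := fun k => α (b k)
  have haJ : ∀ k, a k ∈ J := fun k => hαJ _ (hbG k)
  have haM : ∀ k, ∀ f' ∈ J, Good (f' * b k) → LinearMap.ker (a k) ≤ LinearMap.ker f' →
      LinearMap.ker f' ≤ LinearMap.ker (a k) := fun k => hαM _ (hbG k)
  have hbs' : ∀ k, b (k + 1) = a k * b k := hbs
  let p : ℕ → ℕ → Module.End R M := fun i l => Nat.rec 1 (fun l q => a (i + l) * q) l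
  have hp0' : ∀ i, p i 0 = 1 := fun i => rfl
  have hps : ∀ i l, p i (l + 1) = a (i + l) * p i l := fun i l => rfl
  clear_value p a b
  have hpb : ∀ i l, p i l * b i = b (i + l) := by
    intro i l
    induction l with
    | zero => simp [hp0']
    | succ l ih => rw [hps, mul_assoc, ih, ← add_assoc, hbs']
  have hps' : ∀ i l, p i (l + 1) = p (i + 1) l * a i := by
    intro i l
    induction l with
    | zero => simp [hps, hp0']
    | succ l ih => rw [hps, ih, hps, mul_assoc]; congr 2; omega
  have hpJ : ∀ i l, p i l ∈ J ^ l := by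
    intro i l
    induction l with
    | zero => simp [hp0']
    | succ l ih => rw [hps, pow_succ']; exact Set.mul_mem_mul (haJ _) ih
  have hpJ1 : ∀ i l, p i (l + 1) ∈ J := fun i l => by
    rw [hps]; exact auxCyc_mul_right R (haJ _) _
  have hker1 : ∀ i l, LinearMap.ker (a i) ≤ LinearMap.ker (p i (l + 1)) := by
    intro i l x hx
    have hx' : a i x = 0 := hx
    change p i (l + 1) x = 0
    rw [hps']; simp [hx']
  have hker2 : ∀ i l, LinearMap.ker (p i (l + 1)) ≤ LinearMap.ker (a i) := by
    intro i l
    apply haM i _ (hpJ1 i l) _ (hker1 i l)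
    rw [hpb]; exact hbG _
  have hclaim : ∀ i l, ¬ Good (a i * b (i + (l + 1))) := by
    intro i l hg
    set q := p i (l + 1) with hq
    rw [← hpb, ← mul_assoc, ← hq] at hg
    have hle : LinearMap.ker (a i * q) ≤ LinearMap.ker (a i) := by
      apply haM i _ (auxCyc_mul_right R (haJ i) q) hg
      intro x hx
      have : q x = 0 := hker1 i l hx
      simp [this]
    have hq2 : ∀ x, q (q x) = 0 → q x = 0 := by
      intro x hx
      have h1 : a i (q x) = 0 := hker2 i l hx
      have h2 : x ∈ LinearMap.ker (a i * q) := h1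
      exact hker1 i l (hle h2)
    obtain ⟨m, hm, hr⟩ := hpJ1 i l
    obtain ⟨k, hk⟩ := hnil m hm q hr
    have hq3 : ∀ k x, (q ^ k) (q x) = 0 → q x = 0 := by
      intro k
      induction k with
      | zero => intro x hx; simpa using hx
      | succ k ih =>
        intro x hx
        rw [pow_succ] at hx
        exact hq2 x (ih (q x) hx)
    have hq0 : q = 0 := LinearMap.ext fun x => hq3 k x (by rw [hk]; rfl)
    obtain ⟨x, hx⟩ := hg
    apply hx
    rw [hq0]; simp
  have hclaim' : ∀ i k, i < k → ∀ x, a i (b k x) ∈ A := by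
    intro i k hik x
    obtain ⟨l, rfl⟩ := Nat.exists_eq_add_of_lt hik
    by_contra hc
    exact hclaim i l ⟨x, hc⟩
  apply hud
  refine ⟨fun i => LinearMap.range (b (i + 1)), ?_, ?_⟩
  · apply aux_indep R _ (fun i => p (i + 1) (n + 1))
    · rintro i k hik _ ⟨x, rfl⟩
      rw [hps']
      exact (hA' _).1 (hclaim' (i + 1) (k + 1) (by omega) x) _ (hpJ _ _)
    · rintro i _ ⟨x, rfl⟩ h
      have h1 : (p (i + 1) (n + 1) * b (i + 1)) x = 0 := h
      rw [hpb] at h1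
      have e1 : ∀ k, b k = p 0 k := fun k => by
        have := hpb 0 k
        rw [hb0, mul_one, zero_add] at this
        exact this.symm
      have h2 : x ∈ LinearMap.ker (p 0 (i + 1 + n + 1)) := by
        rw [← e1]; exact h1
      have h3 := hker1 0 i (hker2 0 _ h2)
      rw [e1]; exact h3
  · intro i h
    obtain ⟨x, hx⟩ := hbG (i + 1)
    apply hx
    have : b (i + 1) x ∈ LinearMap.range (b (i + 1)) := ⟨x, rfl⟩
    have h' : LinearMap.range (b (i + 1)) = ⊥ := h
    rw [h'] at this
    rw [(Submodule.mem_bot R).1 this]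
    exact zero_mem _

theorem aux_nilpotent (hproj : IsDirSumSelfProjective R M) (hG : IsGoldieModule R M)
    (N : Submodule R M) (hfi : IsFullyInvariant R N) (hnil : IsNilSubmodule R N) :
    IsNilpotentSubmodule R N := by
  obtain ⟨n, hn⟩ := aux_cyc_nilpotent R hG N hfi hnil
  have key : ∀ k, spowMod R N k ≤
      Submodule.span R {z | ∃ p ∈ (auxCyc R N) ^ k, ∃ y, z = p y} := by
    intro k
    induction k with
    | zero =>
      intro x _
      exact Submodule.subset_span ⟨1, by simp, x, rfl⟩
    | succ k ih =>
      change smulMod R (spowMod R N k) N ≤ _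
      refine iSup_le fun f => ?_
      refine (Submodule.map_mono ih).trans ?_
      rw [Submodule.map_span_le]
      rintro _ ⟨p, hp, y, rfl⟩
      obtain ⟨h, hh1, hh2⟩ := aux_proj_decomp R hproj (fun m : N => R ∙ (m : M))
        (N.subtype ∘ₗ f) (by
          rintro _ ⟨x, rfl⟩
          exact Submodule.mem_iSup_of_mem (f x) (Submodule.mem_span_singleton_self _))
      refine Submodule.span_mono ?_ (hh2 (p y))
      rintro _ ⟨i, rfl⟩
      refine ⟨h i * p, ?_, y, rfl⟩
      rw [pow_succ']
      exact Set.mul_mem_mul ⟨i, i.2, hh1 i⟩ hp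
  refine ⟨n, ?_⟩
  rw [eq_bot_iff]
  refine (key n).trans ?_
  rw [Submodule.span_le]
  rintro _ ⟨p, hp, y, rfl⟩
  rw [hn p hp]; simp

theorem aux_fi_sup {A B : Submodule R M} (hA : IsFullyInvariant R A)
    (hB : IsFullyInvariant R B) : IsFullyInvariant R (A ⊔ B) := by
  intro f
  rw [Submodule.map_sup]
  exact sup_le_sup (hA f) (hB f)

theorem aux_primeRadical_fi : IsFullyInvariant R (primeRadical R M) := by
  intro f
  refine le_sInf fun P hP => ?_
  exact (Submodule.map_mono (sInf_le hP)).trans (hP.1 f)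

theorem aux_primeRadical_nil (hproj : IsDirSumSelfProjective R M) :
    IsNilSubmodule R (primeRadical R M) := by
  intro n hn f hf
  by_contra hnot
  let T : Set (Submodule R M) := {Q | IsFullyInvariant R Q ∧ ∀ k, (f ^ k) n ∉ Q}
  have hfQ : ∀ (Q : Submodule R M) k, (f ^ k) n ∈ Q → LinearMap.range (f ^ (k + 1)) ≤ Q := by
    rintro Q k hk _ ⟨x, rfl⟩
    obtain ⟨c, hc⟩ := Submodule.mem_span_singleton.1 (hf ⟨x, rfl⟩)
    rw [pow_succ, Module.End.mul_apply, ← hc, map_smul]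
    exact Q.smul_mem _ hk
  have hup : ∀ (Q : Submodule R M) k l, (f ^ k) n ∈ Q → (f ^ (k + l)) n ∈ Q := by
    intro Q k l hk
    induction l with
    | zero => exact hk
    | succ l ih => exact hfQ Q (k + l) ih ⟨n, rfl⟩
  have hbot : (⊥ : Submodule R M) ∈ T := by
    refine ⟨fun g => by simp, fun k hk => hnot ⟨k + 1, ?_⟩⟩
    have := hfQ ⊥ k hk
    rwa [le_bot_iff, LinearMap.range_eq_bot] at this
  obtain ⟨Q, -, hQ⟩ := zorn_le_nonempty₀ T (by
    intro c hc hchain y hy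
    have hdir : DirectedOn (· ≤ ·) c := hchain.directedOn
    refine ⟨sSup c, ⟨?_, ?_⟩, fun z hz => le_sSup hz⟩
    · rintro g _ ⟨x, hx, rfl⟩
      obtain ⟨z, hz, hxz⟩ := (Submodule.mem_sSup_of_directed ⟨y, hy⟩ hdir).1 hx
      exact (le_sSup hz : z ≤ sSup c) ((hc hz).1 g ⟨x, hxz, rfl⟩)
    · intro k hk
      obtain ⟨z, hz, hxz⟩ := (Submodule.mem_sSup_of_directed ⟨y, hy⟩ hdir).1 hk
      exact (hc hz).2 k hxz) ⊥ hbot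
  have hQT := hQ.prop
  have hbig : ∀ A : Submodule R M, IsFullyInvariant R A → ¬ A ≤ Q → ∃ k, (f ^ k) n ∈ A ⊔ Q := by
    intro A hA hAQ
    by_contra hc
    push Not at hc
    have hT : A ⊔ Q ∈ T := ⟨aux_fi_sup R hA hQT.1, hc⟩
    exact hAQ (le_sup_left.trans (hQ.le_of_ge hT le_sup_right))
  have hprime : IsPrimeSubmodule R Q := by
    refine ⟨hQT.1, ?_, ?_⟩
    · rintro rfl
      exact hQT.2 0 trivial
    · intro A B hA hB hAB
      by_contra hc
      push Not at hc
      obtain ⟨k, hk⟩ := hbig A hA hc.1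
      obtain ⟨l, hl⟩ := hbig B hB hc.2
      have hr := hfQ _ _ hl
      obtain ⟨h, hh1, hh2⟩ := aux_proj_decomp R hproj
        (fun i : ULift.{v} Bool => if i.down then B else Q) (f ^ (l + 1)) (hr.trans
          (sup_le (le_iSup_of_le ⟨true⟩ (by simp)) (le_iSup_of_le ⟨false⟩ (by simp))))
      obtain ⟨x, hx, q, hq, hxq⟩ := Submodule.mem_sup.1 hk
      apply hQT.2 (l + 1 + k)
      rw [pow_add, Module.End.mul_apply, ← hxq, map_add]
      refine Q.add_mem ?_ (hQT.1 _ ⟨q, hq, rfl⟩)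
      refine (Submodule.span_le.2 ?_) (hh2 x)
      rintro _ ⟨⟨i⟩, rfl⟩
      have h1 := hh1 ⟨i⟩
      cases i
      · exact h1 ⟨x, rfl⟩
      · exact hAB (aux_smulMod_mem R _ h1 hx)
  exact hQT.2 0 ((sInf_le hprime : primeRadical R M ≤ Q) hn)

end NilHelpers

theorem nil_submodule_of_goldie_is_nilpotent {M : Type v} [AddCommGroup M]
    [Module R M] (hproj : IsDirSumSelfProjective R M)
    (hret : IsRetractable R M) (hG : IsGoldieModule R M)
    (N : Submodule R M) (hproper : N ≠ ⊤) (hfi : IsFullyInvariant R N)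
    (hnil : IsNilSubmodule R N) :
    IsNilpotentSubmodule R N ∧ IsNilpotentSubmodule R (primeRadical R M) := by
  exact ⟨aux_nilpotent R hproj hG N hfi hnil,
    aux_nilpotent R hproj hG _ (aux_primeRadical_fi R) (aux_primeRadical_nil R hproj)⟩
end
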